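/- Let 𝔽 be a field, let n ≥ 1 and k ≥ 0, and let M be a k×n matrix over 𝔽. Then the function J_M : ℤ → ℤ defined by J_M(i) := min{ j ≥ i : v(i) ∈ span(v(i+1), …, v(j)) }, where v is the n-periodic sequence of columns of M, is a bijection from ℤ to ℤ. (Together with its periodicity and boundedness, J_M is therefore a bounded juggling pattern of period n.) -/

import Mathlib

noncomputable section
noncomputable section

/-- The `n`-periodic sequence of columns of a `k × n` matrix: `colSeq hn M i`
is the `(i mod n)`-th column of `M`. -/
def colSeq {𝔽 : Type*} [Field 𝔽] {k n : ℕ} (hn : 0 < n)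
    (M : Matrix (Fin k) (Fin n) 𝔽) (i : ℤ) : Fin k → 𝔽 :=
  fun r => M r ⟨(i % (n : ℤ)).toNat, by
    have h1 : 0 ≤ i % (n : ℤ) := Int.emod_nonneg i (by exact_mod_cast hn.ne')
    have h2 : i % (n : ℤ) < (n : ℤ) := Int.emod_lt_of_pos i (by exact_mod_cast hn)
    omega⟩

/-- `v i ∈ span (v (i+1), …, v j)`; the span of the empty family is `{0}`. -/
def spanCond {𝔽 : Type*} [Field 𝔽] {k n : ℕ} (hn : 0 < n)
    (M : Matrix (Fin k) (Fin n) 𝔽) (i j : ℤ) : Prop :=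
  colSeq hn M i ∈ Submodule.span 𝔽 (colSeq hn M '' Set.Ioc i j)

/-- The juggling function of the matrix `M`:
`J_M i = min { j ≥ i : v i ∈ span (v (i+1), …, v j) }`. -/
def JM {𝔽 : Type*} [Field 𝔽] {k n : ℕ} (hn : 0 < n)
    (M : Matrix (Fin k) (Fin n) 𝔽) (i : ℤ) : ℤ :=
  sInf {j : ℤ | i ≤ j ∧ spanCond hn M i j}

/-- `j` is the first index at or after `i` such that `v i` lies in the span of `v (i+1), …, v j`. -/
def IsFirstSpanned (K : Type*) {V : Type*} [Field K] [AddCommGroup V] [Module K V]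
    (v : ℤ → V) (i j : ℤ) : Prop :=
  i ≤ j ∧ v i ∈ Submodule.span K (v '' Set.Ioc i j) ∧
    (i < j → v i ∉ Submodule.span K (v '' Set.Ioo i j))

section SpanSequence

variable {K V : Type*} [Field K] [AddCommGroup V] [Module K V] {v : ℤ → V}

theorem IsFirstSpanned.le_of_mem {i j l : ℤ} (h : IsFirstSpanned K v i j) (hl : i ≤ l)
    (hm : v i ∈ Submodule.span K (v '' Set.Ioc i l)) : j ≤ l := by
  by_contra! hlt
  refine h.2.2 (by omega) (Submodule.span_mono (Set.image_mono ?_) hm)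
  intro x hx
  exact ⟨hx.1, lt_of_le_of_lt hx.2 hlt⟩

theorem IsFirstSpanned.unique {i j l : ℤ} (h : IsFirstSpanned K v i j)
    (h' : IsFirstSpanned K v i l) : j = l :=
  le_antisymm (h.le_of_mem h'.1 h'.2.1) (h'.le_of_mem h.1 h.2.1)

theorem exists_isFirstSpanned {n : ℤ} (hn : 0 < n) (hv : Function.Periodic v n) (i : ℤ) :
    ∃ j, IsFirstSpanned K v i j := by
  obtain ⟨j, ⟨hij, hj⟩, hmin⟩ := Int.exists_least_of_bdd
    (P := fun j => i ≤ j ∧ v i ∈ Submodule.span K (v '' Set.Ioc i j))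
    ⟨i, fun _ h => h.1⟩
    ⟨i + n, by omega, Submodule.subset_span ⟨i + n, ⟨by omega, le_rfl⟩, hv i⟩⟩
  refine ⟨j, hij, hj, fun hlt hmem => ?_⟩
  have := hmin (j - 1) ⟨by omega, by
    convert hmem using 4
    ext x
    simp only [Set.mem_Ioc, Set.mem_Ioo]
    omega⟩
  omega

/-- Reversing the sequence exchanges the roles of the two indices, by the exchange property. -/
theorem IsFirstSpanned.reverse {i j : ℤ} (h : IsFirstSpanned K v i j) :
    IsFirstSpanned K (fun m => v (-m)) (-j) (-i) := by
  obtain ⟨hij, hmem, hnot⟩ := h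
  have hIoc : (fun m => v (-m)) '' Set.Ioc (-j) (-i) = v '' Set.Ico i j := by
    rw [← Function.comp_def v, Set.image_comp, Set.image_neg_eq_neg, Set.neg_Ioc, neg_neg, neg_neg]
  have hIoo : (fun m => v (-m)) '' Set.Ioo (-j) (-i) = v '' Set.Ioo i j := by
    rw [← Function.comp_def v, Set.image_comp, Set.image_neg_eq_neg, Set.neg_Ioo, neg_neg, neg_neg]
  refine ⟨neg_le_neg hij, ?_, fun hlt hm => ?_⟩
  · rw [hIoc]
    simp only [neg_neg]
    rcases hij.eq_or_lt with rfl | hlt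
    · simpa using hmem
    · rw [← Set.Ioo_insert_left hlt, Set.image_insert_eq]
      rw [← Set.Ioo_insert_right hlt, Set.image_insert_eq] at hmem
      exact mem_span_insert_exchange hmem (hnot hlt)
  · have hlt' : i < j := neg_lt_neg_iff.mp hlt
    rw [hIoo] at hm
    simp only [neg_neg] at hm
    rw [← Set.Ioo_insert_right hlt', Set.image_insert_eq,
      Submodule.span_insert_eq_span hm] at hmem
    exact hnot hlt' hmem

end SpanSequence

theorem colSeq_periodic {𝔽 : Type*} [Field 𝔽] {k n : ℕ} (hn : 0 < n)
    (M : Matrix (Fin k) (Fin n) 𝔽) : Function.Periodic (colSeq hn M) (n : ℤ) := by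
  intro i
  funext r
  simp only [colSeq, Int.add_emod_right]

theorem JM_eq_of_isFirstSpanned {𝔽 : Type*} [Field 𝔽] {k n : ℕ} (hn : 0 < n)
    (M : Matrix (Fin k) (Fin n) 𝔽) {i j : ℤ} (h : IsFirstSpanned 𝔽 (colSeq hn M) i j) :
    JM hn M i = j :=
  IsLeast.csInf_eq ⟨⟨h.1, h.2.1⟩, fun _ hl => h.le_of_mem hl.1 hl.2⟩

theorem isFirstSpanned_JM {𝔽 : Type*} [Field 𝔽] {k n : ℕ} (hn : 0 < n)
    (M : Matrix (Fin k) (Fin n) 𝔽) (i : ℤ) :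
    IsFirstSpanned 𝔽 (colSeq hn M) i (JM hn M i) := by
  obtain ⟨j, hj⟩ := exists_isFirstSpanned (K := 𝔽) (Int.natCast_pos.mpr hn) (colSeq_periodic hn M) i
  rwa [JM_eq_of_isFirstSpanned hn M hj]

/-- The function `J_M` is a bijection from ℤ to ℤ (together with its
periodicity and boundedness it is therefore a bounded juggling pattern of
period `n`). -/
theorem JM_bijective {𝔽 : Type*} [Field 𝔽] (k n : ℕ) (hn : 0 < n)
    (M : Matrix (Fin k) (Fin n) 𝔽) :
    Function.Bijective (JM hn M) := by
  refine ⟨fun a b hab => ?_, fun j => ?_⟩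
  · have ha := (isFirstSpanned_JM hn M a).reverse
    have hb := (isFirstSpanned_JM hn M b).reverse
    rw [hab] at ha
    exact neg_injective (ha.unique hb)
  · have hper : Function.Periodic (fun m => colSeq hn M (-m)) (n : ℤ) := fun m => by
      simpa only [neg_add'] using (colSeq_periodic hn M).sub_eq (-m)
    obtain ⟨i, hi⟩ := exists_isFirstSpanned (K := 𝔽) (Int.natCast_pos.mpr hn) hper (-j)
    refine ⟨-i, JM_eq_of_isFirstSpanned hn M ?_⟩
    simpa using hi.reverse

end
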